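/- arXiv:2508.13611 — 13 statements merged into one kernel-verified Lean document; each statement's English description precedes it below -/
import Mathlib

section
/- Let P be a process LTS and E an environment LTS over the same action set A. For all processes p, q of P and every environment e of E: p ⊑_e q (p can be simulated by q with respect to e, via an E-parameterized simulation) if and only if the state p⊕e can be simulated by the state q⊕e in the right-determinizing join LTS P ⊕ E. -/
/-- A simulation from the LTS `tr1` to the LTS `tr2` (over the same action set). -/
def IsSim {A St1 St2 : Type*} (tr1 : St1 → A → St1 → Prop)
    (tr2 : St2 → A → St2 → Prop) (S : St1 → St2 → Prop) : Prop :=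
  ∀ s t, S s t → ∀ a s', tr1 s a s' → ∃ t', tr2 t a t' ∧ S s' t'

/-- `s` can be simulated by `t`. -/
def SimBy {A St1 St2 : Type*} (tr1 : St1 → A → St1 → Prop)
    (tr2 : St2 → A → St2 → Prop) (s : St1) (t : St2) : Prop :=
  ∃ S, IsSim tr1 tr2 S ∧ S s t

/-- A bisimulation on the LTS `tr`: both `B` and its converse are simulations. -/
def IsBisim {A St : Type*} (tr : St → A → St → Prop) (B : St → St → Prop) : Prop :=
  IsSim tr tr B ∧ IsSim tr tr (fun t s => B s t)

/-- `s` and `t` are bisimilar. -/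
def Bisim {A St : Type*} (tr : St → A → St → Prop) (s t : St) : Prop :=
  ∃ B, IsBisim tr B ∧ B s t

/-- The join-interaction LTS `T1 & T2`: simultaneous equally-labeled transitions. -/
def joinTr {A St1 St2 : Type*} (tr1 : St1 → A → St1 → Prop)
    (tr2 : St2 → A → St2 → Prop) : St1 × St2 → A → St1 × St2 → Prop :=
  fun s a s' => tr1 s.1 a s'.1 ∧ tr2 s.2 a s'.2

/-- The right-determinizing join LTS `P ⊕ E`: actions are pairs `(a, e')`
    recording the target of the environment transition. -/
def dotTr {A Pr Env : Type*} (tr : Pr → A → Pr → Prop)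
    (trE : Env → A → Env → Prop) : Pr × Env → A × Env → Pr × Env → Prop :=
  fun s l s' => tr s.1 l.1 s'.1 ∧ trE s.2 l.1 s'.2 ∧ s'.2 = l.2

/-- An `E`-parameterized simulation on the process LTS `tr`. -/
def IsParamSim {A Pr Env : Type*} (tr : Pr → A → Pr → Prop)
    (trE : Env → A → Env → Prop) (S : Env → Pr → Pr → Prop) : Prop :=
  ∀ e p q, S e p q → ∀ a e', trE e a e' → ∀ p', tr p a p' →
    ∃ q', tr q a q' ∧ S e' p' q'

/-- `p ⊑_e q`: `p` can be simulated by `q` with respect to environment `e`. -/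
def ParamSimBy {A Pr Env : Type*} (tr : Pr → A → Pr → Prop)
    (trE : Env → A → Env → Prop) (e : Env) (p q : Pr) : Prop :=
  ∃ S, IsParamSim tr trE S ∧ S e p q

/-- An `E`-parameterized bisimulation on the process LTS `tr`. -/
def IsParamBisim {A Pr Env : Type*} (tr : Pr → A → Pr → Prop)
    (trE : Env → A → Env → Prop) (B : Env → Pr → Pr → Prop) : Prop :=
  ∀ e p q, B e p q → ∀ a e', trE e a e' →
    ((∀ p', tr p a p' → ∃ q', tr q a q' ∧ B e' p' q') ∧
     (∀ q', tr q a q' → ∃ p', tr p a p' ∧ B e' p' q'))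

/-- `p ∼_e q`: `p` and `q` are bisimilar with respect to environment `e`. -/
def ParamBisim {A Pr Env : Type*} (tr : Pr → A → Pr → Prop)
    (trE : Env → A → Env → Prop) (e : Env) (p q : Pr) : Prop :=
  ∃ B, IsParamBisim tr trE B ∧ B e p q

/-- Reachability via a path of transitions. -/
def Reachable {A St : Type*} (tr : St → A → St → Prop) : St → St → Prop :=
  Relation.ReflTransGen (fun s t => ∃ a, tr s a t)

/-- A state is deterministic if every reachable state has at most one
    `a`-derivative, for each action `a`. -/
def Deterministic {A St : Type*} (tr : St → A → St → Prop) (s : St) : Prop :=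
  ∀ t, Reachable tr s t → ∀ (a : A) (t1 t2 : St), tr t a t1 → tr t a t2 → t1 = t2

/-- A state is image-finite if every reachable state has only finitely many
    `a`-derivatives, for each action `a`. -/
def ImageFinite {A St : Type*} (tr : St → A → St → Prop) (s : St) : Prop :=
  ∀ t, Reachable tr s t → ∀ a : A, {t' | tr t a t'}.Finite

/-- Positive modal formulas: `⊤`, conjunction, diamond modalities. -/
inductive PosForm (A : Type*) where
  | top : PosForm A
  | and : PosForm A → PosForm A → PosForm A
  | dia : A → PosForm A → PosForm A

/-- Satisfaction of positive formulas. -/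
def psat {A St : Type*} (tr : St → A → St → Prop) : PosForm A → St → Prop
  | .top, _ => True
  | .and φ ψ, s => psat tr φ s ∧ psat tr ψ s
  | .dia a φ, s => ∃ s', tr s a s' ∧ psat tr φ s'

/-- The set of positive formulas satisfied by a state. -/
def posSat {A St : Type*} (tr : St → A → St → Prop) (s : St) : Set (PosForm A) :=
  {φ | psat tr φ s}

/-- Simple modal formulas: `⊤`, negation, conjunction, diamond modalities. -/
inductive Form (A : Type*) where
  | top : Form A
  | neg : Form A → Form A
  | and : Form A → Form A → Form A
  | dia : A → Form A → Form A

/-- Satisfaction of modal formulas. -/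
def msat {A St : Type*} (tr : St → A → St → Prop) : Form A → St → Prop
  | .top, _ => True
  | .neg φ, s => ¬ msat tr φ s
  | .and φ ψ, s => msat tr φ s ∧ msat tr ψ s
  | .dia a φ, s => ∃ s', tr s a s' ∧ msat tr φ s'

/-- The set of modal formulas satisfied by a state. -/
def modalSat {A St : Type*} (tr : St → A → St → Prop) (s : St) : Set (Form A) :=
  {φ | msat tr φ s}

/-- The positive-formula projection, erasing negations. -/
def posProj {A : Type*} : Form A → PosForm A
  | .top => .top
  | .neg φ => posProj φ
  | .and φ ψ => .and (posProj φ) (posProj ψ)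
  | .dia a φ => .dia a (posProj φ)

/-- Negation closure of a set of positive formulas. -/
def negClosure {A : Type*} (Φ : Set (PosForm A)) : Set (Form A) :=
  {ψ | posProj ψ ∈ Φ}

theorem stmt0 {A Pr Env : Type*} (tr : Pr → A → Pr → Prop)
    (trE : Env → A → Env → Prop) (p q : Pr) (e : Env) :
    ParamSimBy tr trE e p q ↔
      SimBy (dotTr tr trE) (dotTr tr trE) (p, e) (q, e) := by
  constructor
  · rintro ⟨S, hS, hpq⟩
    refine ⟨fun s t => s.2 = t.2 ∧ S s.2 s.1 t.1, ?_, rfl, hpq⟩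
    rintro ⟨p, e⟩ ⟨q, f⟩ ⟨hef, h⟩ ⟨a, e'⟩ ⟨p', g⟩ ⟨hp, he, hg⟩
    dsimp only at hef h hp he hg
    subst hef hg
    obtain ⟨q', hq, h'⟩ := hS _ _ _ h _ _ he _ hp
    exact ⟨(q', g), ⟨hq, he, rfl⟩, rfl, h'⟩
  · rintro ⟨S, hS, hpq⟩
    refine ⟨fun e p q => S (p, e) (q, e), ?_, hpq⟩
    intro e p q h a e' he p' hp
    obtain ⟨⟨q', g⟩, ⟨hq, -, hg⟩, h'⟩ := hS _ _ h (a, e') (p', e') ⟨hp, he, rfl⟩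
    dsimp only at hq hg
    subst hg
    exact ⟨q', hq, h'⟩
end

section
/- Let P be a process LTS and E an environment LTS over the same action set A. For all processes p, q of P and every environment e of E: p ∼_e q (p and q are bisimilar with respect to e, via an E-parameterized bisimulation) if and only if the states p⊕e and q⊕e are bisimilar in the right-determinizing join LTS P ⊕ E. -/
/-- A parameterized bisimulation induces a bisimulation on the right-determinizing join,
relating states with a common environment component. -/
theorem IsParamBisim.isBisim_dotTr {A Pr Env : Type*} {tr : Pr → A → Pr → Prop}
    {trE : Env → A → Env → Prop} {B : Env → Pr → Pr → Prop} (hB : IsParamBisim tr trE B) :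
    IsBisim (dotTr tr trE) (fun s t => s.2 = t.2 ∧ B s.2 s.1 t.1) := by
  constructor
  · rintro ⟨p, e⟩ ⟨q, _⟩ ⟨rfl, h⟩ ⟨a, _⟩ ⟨p', e'⟩ ⟨hp, he, rfl⟩
    obtain ⟨q', hq, h'⟩ := (hB _ _ _ h a e' he).1 p' hp
    exact ⟨(q', e'), ⟨hq, he, rfl⟩, rfl, h'⟩
  · rintro ⟨q, _⟩ ⟨p, e⟩ ⟨rfl, h⟩ ⟨a, _⟩ ⟨q', e'⟩ ⟨hq, he, rfl⟩
    obtain ⟨p', hp, h'⟩ := (hB _ _ _ h a e' he).2 q' hq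
    exact ⟨(p', e'), ⟨hp, he, rfl⟩, rfl, h'⟩

/-- A bisimulation on the right-determinizing join restricts to a parameterized bisimulation. -/
theorem IsBisim.isParamBisim {A Pr Env : Type*} {tr : Pr → A → Pr → Prop}
    {trE : Env → A → Env → Prop} {B : Pr × Env → Pr × Env → Prop}
    (hB : IsBisim (dotTr tr trE) B) :
    IsParamBisim tr trE (fun e p q => B (p, e) (q, e)) := by
  intro e p q h a e' he
  constructor
  · intro p' hp
    obtain ⟨⟨q', _⟩, ⟨hq, _, rfl⟩, h'⟩ := hB.1 _ _ h (a, e') (p', e') ⟨hp, he, rfl⟩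
    exact ⟨q', hq, h'⟩
  · intro q' hq
    obtain ⟨⟨p', _⟩, ⟨hp, _, rfl⟩, h'⟩ := hB.2 _ _ h (a, e') (q', e') ⟨hq, he, rfl⟩
    exact ⟨p', hp, h'⟩

theorem stmt1 {A Pr Env : Type*} (tr : Pr → A → Pr → Prop)
    (trE : Env → A → Env → Prop) (p q : Pr) (e : Env) :
    ParamBisim tr trE e p q ↔ Bisim (dotTr tr trE) (p, e) (q, e) := by
  constructor
  · rintro ⟨B, hB, h⟩
    exact ⟨_, hB.isBisim_dotTr, rfl, h⟩
  · rintro ⟨B, hB, h⟩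
    exact ⟨_, hB.isParamBisim, h⟩
end

section
/- Let P be a process LTS and E an environment LTS over the same action set A. For all processes p, q of P and every environment e of E: (1) if p⊕e can be simulated by q⊕e in the right-determinizing join LTS P ⊕ E, then p&e can be simulated by q&e in the join-interaction LTS P & E; and (2) if p⊕e and q⊕e are bisimilar in P ⊕ E, then p&e and q&e are bisimilar in P & E. -/
/-- A simulation between right-determinizing joins is a simulation between the
    corresponding join-interaction systems. -/
theorem IsSim.join_of_dot {A Pr1 Pr2 Env : Type*} {tr1 : Pr1 → A → Pr1 → Prop}
    {tr2 : Pr2 → A → Pr2 → Prop} {trE : Env → A → Env → Prop}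
    {S : Pr1 × Env → Pr2 × Env → Prop}
    (hS : IsSim (dotTr tr1 trE) (dotTr tr2 trE) S) :
    IsSim (joinTr tr1 trE) (joinTr tr2 trE) S := by
  intro s t hst a s' hs
  obtain ⟨t', ⟨htr, htrE, -⟩, hst'⟩ := hS s t hst (a, s'.2) s' ⟨hs.1, hs.2, rfl⟩
  exact ⟨t', ⟨htr, htrE⟩, hst'⟩

theorem stmt2 {A Pr Env : Type*} (tr : Pr → A → Pr → Prop)
    (trE : Env → A → Env → Prop) (p q : Pr) (e : Env) :
    (SimBy (dotTr tr trE) (dotTr tr trE) (p, e) (q, e) →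
      SimBy (joinTr tr trE) (joinTr tr trE) (p, e) (q, e)) ∧
    (Bisim (dotTr tr trE) (p, e) (q, e) →
      Bisim (joinTr tr trE) (p, e) (q, e)) := by
  exact ⟨fun ⟨S, hS, h⟩ => ⟨S, hS.join_of_dot, h⟩,
    fun ⟨B, hB, h⟩ => ⟨B, ⟨hB.1.join_of_dot, hB.2.join_of_dot⟩, h⟩⟩
end

section
/- Let P be a process LTS and E an environment LTS over the same action set A. For every deterministic environment e of E, parameterized bisimilarity with respect to e coincides with ji-parameterized bisimilarity with respect to e: for all processes p, q of P, p ∼_e q holds if and only if p&e and q&e are bisimilar in the join-interaction LTS P & E. -/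
/-- Parameterized bisimilarity implies bisimilarity of the join-interactions,
    for every environment. -/
theorem ParamBisim.bisim_joinTr {A Pr Env : Type*} {tr : Pr → A → Pr → Prop}
    {trE : Env → A → Env → Prop} {e : Env} {p q : Pr} (h : ParamBisim tr trE e p q) :
    Bisim (joinTr tr trE) (p, e) (q, e) := by
  obtain ⟨B, hB, hpq⟩ := h
  refine ⟨fun s t => s.2 = t.2 ∧ B s.2 s.1 t.1, ⟨?_, ?_⟩, rfl, hpq⟩
  · rintro ⟨p, f⟩ ⟨q, g⟩ ⟨rfl, hpq⟩ a ⟨p', f'⟩ ⟨hp, hf⟩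
    obtain ⟨q', hq, hpq'⟩ := (hB f p q hpq a f' hf).1 p' hp
    exact ⟨(q', f'), ⟨hq, hf⟩, rfl, hpq'⟩
  · rintro ⟨q, g⟩ ⟨p, f⟩ ⟨rfl, hpq⟩ a ⟨q', f'⟩ ⟨hq, hf⟩
    obtain ⟨p', hp, hpq'⟩ := (hB f p q hpq a f' hf).2 q' hq
    exact ⟨(p', f'), ⟨hp, hf⟩, rfl, hpq'⟩

/-- Over a deterministic environment, bisimilarity of the join-interactions implies
    parameterized bisimilarity. -/
theorem Bisim.paramBisim_of_deterministic {A Pr Env : Type*} {tr : Pr → A → Pr → Prop}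
    {trE : Env → A → Env → Prop} {e : Env} {p q : Pr} (hdet : Deterministic trE e)
    (h : Bisim (joinTr tr trE) (p, e) (q, e)) : ParamBisim tr trE e p q := by
  obtain ⟨B, ⟨hforth, hback⟩, hpq⟩ := h
  refine ⟨fun f p q => Reachable trE e f ∧ B (p, f) (q, f), ?_, .refl, hpq⟩
  rintro f p q ⟨hreach, hpq⟩ a f' hf
  have hreach' : Reachable trE e f' := hreach.tail ⟨a, hf⟩
  constructor
  · intro p' hp
    obtain ⟨⟨q', g⟩, ⟨hq, hg⟩, hpq'⟩ := hforth _ _ hpq a (p', f') ⟨hp, hf⟩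
    obtain rfl : g = f' := hdet f hreach a g f' hg hf
    exact ⟨q', hq, hreach', hpq'⟩
  · intro q' hq
    obtain ⟨⟨p', g⟩, ⟨hp, hg⟩, hpq'⟩ := hback _ _ hpq a (q', f') ⟨hq, hf⟩
    obtain rfl : g = f' := hdet f hreach a g f' hg hf
    exact ⟨p', hp, hreach', hpq'⟩

theorem stmt3 {A Pr Env : Type*} (tr : Pr → A → Pr → Prop)
    (trE : Env → A → Env → Prop) (e : Env) (hdet : Deterministic trE e)
    (p q : Pr) :
    ParamBisim tr trE e p q ↔ Bisim (joinTr tr trE) (p, e) (q, e) :=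
  ⟨ParamBisim.bisim_joinTr, Bisim.paramBisim_of_deterministic hdet⟩
end

section
/- Let P be a process LTS and E an environment LTS over the same action set A. For every environment e of E, parameterized bisimilarity is included in ji-parameterized bisimilarity: for all processes p, q of P, if p ∼_e q then p&e and q&e are bisimilar in the join-interaction LTS P & E. -/
theorem stmt4 {A Pr Env : Type*} (tr : Pr → A → Pr → Prop)
    (trE : Env → A → Env → Prop) (e : Env) (p q : Pr) :
    ParamBisim tr trE e p q → Bisim (joinTr tr trE) (p, e) (q, e) := by
  rintro ⟨B, hB, hpq⟩
  refine ⟨fun s t => s.2 = t.2 ∧ B s.2 s.1 t.1, ⟨?_, ?_⟩, rfl, hpq⟩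
  · rintro ⟨p, e⟩ ⟨q, f⟩ ⟨hef, h⟩ a ⟨p', e'⟩ ⟨hp, he⟩
    dsimp only at hef h hp he
    subst hef
    obtain ⟨q', hq, h'⟩ := (hB e p q h a e' he).1 p' hp
    exact ⟨(q', e'), ⟨hq, he⟩, rfl, h'⟩
  · rintro ⟨q, f⟩ ⟨p, e⟩ ⟨hef, h⟩ a ⟨q', e'⟩ ⟨hq, he⟩
    dsimp only at hef h hq he
    subst hef
    obtain ⟨p', hp, h'⟩ := (hB e p q h a e' he).2 q' hq
    exact ⟨(p', e'), ⟨hp, he⟩, rfl, h'⟩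
end

section
/- In the concrete finite LTS T over actions {a,b} (used both as process LTS and environment LTS), taking environment e = E (representing a.b + a), process p = AB (representing a.b), and process q = E, it holds that p&e and q&e are bisimilar in the join-interaction LTS T & T (so p and q are ji-parameterized bisimilar with respect to e), while p ∼_e q fails (p and q are not parameterized bisimilar with respect to e). Hence parameterized bisimilarity with respect to e is strictly included in ji-parameterized bisimilarity with respect to e. -/
/-- States of the concrete finite LTS `T`. -/
inductive St5 where
  | zero | A | B | AB | E
  deriving DecidableEq

/-- The two actions `a` and `b` (distinct by construction). -/
inductive Act2 where
  | a | b
  deriving DecidableEq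

/-- Transitions of the concrete finite LTS `T`:
    `A →a 0`, `B →b 0`, `AB →a B`, `E →a B`, `E →a 0`. -/
def tr5 : St5 → Act2 → St5 → Prop :=
  fun s x t =>
    (s = .A ∧ x = .a ∧ t = .zero) ∨
    (s = .B ∧ x = .b ∧ t = .zero) ∨
    (s = .AB ∧ x = .a ∧ t = .B) ∨
    (s = .E ∧ x = .a ∧ t = .B) ∨
    (s = .E ∧ x = .a ∧ t = .zero)

/-- A state without outgoing transitions. -/
def Deadlocked {A St : Type*} (tr : St → A → St → Prop) (s : St) : Prop :=
  ∀ a t, ¬ tr s a t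

/-- If each transition of `s` is matched by a transition of `t`, and conversely, up to equality or
deadlock of both targets, then `s` and `t` are bisimilar. -/
theorem Bisim.of_match_up_to_deadlock {A St : Type*} {tr : St → A → St → Prop} {s t : St}
    (forth : ∀ a s', tr s a s' → ∃ t', tr t a t' ∧
      (s' = t' ∨ Deadlocked tr s' ∧ Deadlocked tr t'))
    (back : ∀ a t', tr t a t' → ∃ s', tr s a s' ∧
      (s' = t' ∨ Deadlocked tr s' ∧ Deadlocked tr t')) :
    Bisim tr s t := by
  refine ⟨fun x y => (x = s ∧ y = t) ∨ (x = y ∨ Deadlocked tr x ∧ Deadlocked tr y),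
    ⟨?_, ?_⟩, Or.inl ⟨rfl, rfl⟩⟩
  · rintro x y (⟨rfl, rfl⟩ | rfl | ⟨hx, -⟩) a x' h
    · obtain ⟨y', hy, hr⟩ := forth a x' h
      exact ⟨y', hy, Or.inr hr⟩
    · exact ⟨x', h, Or.inr (Or.inl rfl)⟩
    · exact (hx a x' h).elim
  · rintro y x (⟨rfl, rfl⟩ | rfl | ⟨-, hy⟩) a y' h
    · obtain ⟨x', hx, hr⟩ := back a y' h
      exact ⟨x', hx, Or.inr hr⟩
    · exact ⟨y', h, Or.inr (Or.inl rfl)⟩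
    · exact (hy a y' h).elim

theorem deadlocked_tr5_zero : Deadlocked tr5 St5.zero := by
  simp [Deadlocked, tr5]

theorem Deadlocked.joinTr_left {A St1 St2 : Type*} {tr1 : St1 → A → St1 → Prop} {s : St1}
    (h : Deadlocked tr1 s) (tr2 : St2 → A → St2 → Prop) (t : St2) :
    Deadlocked (joinTr tr1 tr2) (s, t) :=
  fun a s' hs => h a s'.1 hs.1

theorem Deadlocked.joinTr_right {A St1 St2 : Type*} {tr2 : St2 → A → St2 → Prop} {t : St2}
    (h : Deadlocked tr2 t) (tr1 : St1 → A → St1 → Prop) (s : St1) :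
    Deadlocked (joinTr tr1 tr2) (s, t) :=
  fun a s' hs => h a s'.2 hs.2

theorem tr5_AB_iff {x : Act2} {t : St5} : tr5 .AB x t ↔ x = .a ∧ t = .B := by
  simp [tr5]

theorem tr5_E_iff {x : Act2} {t : St5} : tr5 .E x t ↔ x = .a ∧ (t = .B ∨ t = .zero) := by
  simp [tr5, and_or_left]

theorem tr5_B_iff {x : Act2} {t : St5} : tr5 .B x t ↔ x = .b ∧ t = .zero := by
  simp [tr5]

theorem bisim_joinTr_AB_E : Bisim (joinTr tr5 tr5) (St5.AB, St5.E) (St5.E, St5.E) := by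
  have left := deadlocked_tr5_zero.joinTr_left tr5
  have right := deadlocked_tr5_zero.joinTr_right tr5
  refine .of_match_up_to_deadlock ?_ ?_
  · rintro x ⟨p, e⟩ ⟨hp, he⟩
    obtain ⟨rfl, rfl⟩ := tr5_AB_iff.1 hp
    exact ⟨(.B, e), ⟨tr5_E_iff.2 ⟨rfl, .inl rfl⟩, he⟩, .inl rfl⟩
  · rintro x ⟨q, e⟩ ⟨hq, he⟩
    obtain ⟨rfl, rfl | rfl⟩ := tr5_E_iff.1 hq
    · exact ⟨(.B, e), ⟨tr5_AB_iff.2 ⟨rfl, rfl⟩, he⟩, .inl rfl⟩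
    · exact ⟨(.B, .zero), ⟨tr5_AB_iff.2 ⟨rfl, rfl⟩, tr5_E_iff.2 ⟨rfl, .inr rfl⟩⟩,
        .inr ⟨right _, left _⟩⟩

theorem not_paramBisim_AB_E : ¬ ParamBisim tr5 tr5 St5.E St5.AB St5.E := by
  rintro ⟨B, hB, h⟩
  obtain ⟨p, hp, hr⟩ := (hB _ _ _ h .a .B (tr5_E_iff.2 ⟨rfl, .inl rfl⟩)).2 .zero
    (tr5_E_iff.2 ⟨rfl, .inr rfl⟩)
  obtain ⟨-, rfl⟩ := tr5_AB_iff.1 hp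
  have hb : tr5 .B .b .zero := tr5_B_iff.2 ⟨rfl, rfl⟩
  obtain ⟨q, hq, -⟩ := (hB _ _ _ hr .b .zero hb).1 .zero hb
  exact deadlocked_tr5_zero _ _ hq

theorem stmt5 :
    Bisim (joinTr tr5 tr5) (St5.AB, St5.E) (St5.E, St5.E) ∧
    ¬ ParamBisim tr5 tr5 St5.E St5.AB St5.E :=
  ⟨bisim_joinTr_AB_E, not_paramBisim_AB_E⟩
end

section
/- In the concrete finite LTS T over actions {a,b} (used both as process LTS and environment LTS), taking environment e = AB (representing a.b), process p = AB, and process q = E (representing a.b + a), it holds that p ji≃_e q (p&e and q&e simulate each other in the join-interaction LTS T & T) while p&e and q&e are not bisimilar in T & T (so p ji∼_e q fails). Hence ji-parameterized bisimilarity with respect to e is strictly included in ji-parameterized simulation equivalence with respect to e. -/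
theorem stmt7 :
    (SimBy (joinTr tr5 tr5) (joinTr tr5 tr5) (St5.AB, St5.AB) (St5.E, St5.AB) ∧
     SimBy (joinTr tr5 tr5) (joinTr tr5 tr5) (St5.E, St5.AB) (St5.AB, St5.AB)) ∧
    ¬ Bisim (joinTr tr5 tr5) (St5.AB, St5.AB) (St5.E, St5.AB) := by
  refine ⟨⟨⟨fun s t => s = t ∨ s = (.AB, .AB) ∧ t = (.E, .AB), ?_, by simp⟩,
    ⟨fun s t => s = t ∨ (s = (.E, .AB) ∧ t = (.AB, .AB)) ∨ s = (.zero, .B) ∧ t = (.B, .B),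
      ?_, by simp⟩⟩, ?_⟩
  · rintro s t (rfl | ⟨rfl, rfl⟩) x s' h
    · exact ⟨s', h, .inl rfl⟩
    · exact ⟨s', by simp_all [joinTr, tr5], .inl rfl⟩
  · rintro s t (rfl | ⟨rfl, rfl⟩ | ⟨rfl, rfl⟩) x ⟨p, e⟩ h
    · exact ⟨_, h, .inl rfl⟩
    · refine ⟨(.B, .B), ?_, ?_⟩ <;> simp_all [joinTr, tr5]
      tauto
    · simp [joinTr, tr5] at h
  · rintro ⟨B, ⟨forth, back⟩, hB⟩
    obtain ⟨⟨p, e⟩, hp, hB'⟩ := back _ _ hB .a (.zero, .B) (by simp [joinTr, tr5])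
    obtain ⟨rfl, rfl⟩ : p = .B ∧ e = .B := by simpa [joinTr, tr5] using hp
    obtain ⟨r, hr, -⟩ := forth _ _ hB' .b (.zero, .zero) (by simp [joinTr, tr5])
    simp [joinTr, tr5] at hr
end

section
/- Let P be a process LTS and E an environment LTS over the same action set A. For every environment e of E, ji-parameterized simulatability is included in parameterized simulatability: for all processes p, q of P, if p&e can be simulated by q&e in the join-interaction LTS P & E, then p ⊑_e q (there is an E-parameterized simulation relating p and q at e). -/
theorem stmt8 {A Pr Env : Type*} (tr : Pr → A → Pr → Prop)
    (trE : Env → A → Env → Prop) (e : Env) (p q : Pr) :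
    SimBy (joinTr tr trE) (joinTr tr trE) (p, e) (q, e) →
      ParamSimBy tr trE e p q := by
  rintro ⟨S, hS, h⟩
  refine ⟨fun e p q => ∃ f, S (p, e) (q, f), ?_, e, h⟩
  rintro e p q ⟨f, hf⟩ a e' he p' hp
  obtain ⟨⟨q', f'⟩, ⟨hq, -⟩, h'⟩ := hS _ _ hf a (p', e') ⟨hp, he⟩
  exact ⟨q', hq, f', h'⟩
end

section
/- Let P be a process LTS and E an environment LTS over the same action set A. For every environment e of E: (1) ji-parameterized simulatability coincides with parameterized simulatability, i.e. for all processes p, q, p&e ≤ q&e in the join-interaction LTS P & E if and only if p ⊑_e q; and (2) ji-parameterized simulation equivalence coincides with parameterized simulation equivalence, i.e. p ji≃_e q if and only if p ⊑_e q and q ⊑_e p. -/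
theorem ParamSimBy.of_simBy_joinTr {A Pr Env : Type*} {tr : Pr → A → Pr → Prop}
    {trE : Env → A → Env → Prop} {e g : Env} {p q : Pr}
    (h : SimBy (joinTr tr trE) (joinTr tr trE) (p, e) (q, g)) :
    ParamSimBy tr trE e p q := by
  obtain ⟨S, hS, hpq⟩ := h
  refine ⟨fun f p q => ∃ g, S (p, f) (q, g), ?_, g, hpq⟩
  rintro f p q ⟨g, hpq⟩ a f' hf p' hp
  obtain ⟨⟨q', g'⟩, hq, hpq'⟩ := hS _ _ hpq a (p', f') ⟨hp, hf⟩
  exact ⟨q', hq.1, g', hpq'⟩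

theorem ParamSimBy.simBy_joinTr {A Pr Env : Type*} {tr : Pr → A → Pr → Prop}
    {trE : Env → A → Env → Prop} {e : Env} {p q : Pr} (h : ParamSimBy tr trE e p q) :
    SimBy (joinTr tr trE) (joinTr tr trE) (p, e) (q, e) := by
  obtain ⟨S, hS, hpq⟩ := h
  refine ⟨fun s t => s.2 = t.2 ∧ S s.2 s.1 t.1, ?_, rfl, hpq⟩
  rintro ⟨p, f⟩ ⟨q, _⟩ ⟨rfl, hpq⟩ a ⟨p', f'⟩ ⟨hp, hf⟩
  obtain ⟨q', hq, hpq'⟩ := hS f p q hpq a f' hf p' hp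
  exact ⟨(q', f'), ⟨hq, hf⟩, rfl, hpq'⟩

theorem simBy_joinTr_iff_paramSimBy {A Pr Env : Type*} {tr : Pr → A → Pr → Prop}
    {trE : Env → A → Env → Prop} {e : Env} {p q : Pr} :
    SimBy (joinTr tr trE) (joinTr tr trE) (p, e) (q, e) ↔ ParamSimBy tr trE e p q :=
  ⟨ParamSimBy.of_simBy_joinTr, ParamSimBy.simBy_joinTr⟩

theorem stmt10 {A Pr Env : Type*} (tr : Pr → A → Pr → Prop)
    (trE : Env → A → Env → Prop) (e : Env) (p q : Pr) :
    (SimBy (joinTr tr trE) (joinTr tr trE) (p, e) (q, e) ↔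
      ParamSimBy tr trE e p q) ∧
    ((SimBy (joinTr tr trE) (joinTr tr trE) (p, e) (q, e) ∧
      SimBy (joinTr tr trE) (joinTr tr trE) (q, e) (p, e)) ↔
      (ParamSimBy tr trE e p q ∧ ParamSimBy tr trE e q p)) := by
  exact ⟨simBy_joinTr_iff_paramSimBy,
    and_congr simBy_joinTr_iff_paramSimBy simBy_joinTr_iff_paramSimBy⟩
end

section
/- In the concrete finite LTS T over actions {a,b} (used both as process LTS and environment LTS), taking environments e = AB (representing a.b) and f = E (representing a.b + a), it holds that e can be simulated by f (e ≤ f in T), yet ji-parameterized bisimilarity with respect to f is not included in ji-parameterized bisimilarity with respect to e: concretely, for p = AB and q = E one has p&f ∼ q&f in T & T but p&e and q&e are not bisimilar in T & T. Hence the simulation preorder on environments does not characterize the discrimination preorder generated by ji-parameterized bisimilarity. -/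
/-- The extension of `R` by equality and by all pairs of deadlocked states. -/
def upToDeadlock {A St : Type*} (tr : St → A → St → Prop) (R : St → St → Prop)
    (s t : St) : Prop :=
  R s t ∨ s = t ∨ ((∀ x s', ¬ tr s x s') ∧ ∀ x t', ¬ tr t x t')

theorem isBisim_upToDeadlock {A St : Type*} {tr : St → A → St → Prop} {R : St → St → Prop}
    (hl : ∀ s t, R s t → ∀ x s', tr s x s' → ∃ t', tr t x t' ∧ upToDeadlock tr R s' t')
    (hr : ∀ s t, R s t → ∀ x t', tr t x t' → ∃ s', tr s x s' ∧ upToDeadlock tr R s' t') :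
    IsBisim tr (upToDeadlock tr R) := by
  constructor
  · rintro s t (h | rfl | h) x s' hs
    · exact hl s t h x s' hs
    · exact ⟨s', hs, Or.inr (Or.inl rfl)⟩
    · exact absurd hs (h.1 x s')
  · rintro t s (h | rfl | h) x t' ht
    · exact hr s t h x t' ht
    · exact ⟨t', ht, Or.inr (Or.inl rfl)⟩
    · exact absurd ht (h.2 x t')

theorem stmt11 :
    SimBy tr5 tr5 St5.AB St5.E ∧
    Bisim (joinTr tr5 tr5) (St5.AB, St5.E) (St5.E, St5.E) ∧
    ¬ Bisim (joinTr tr5 tr5) (St5.AB, St5.AB) (St5.E, St5.AB) := by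
  refine ⟨⟨fun s t => s = t ∨ (s = .AB ∧ t = .E), ?_, Or.inr ⟨rfl, rfl⟩⟩,
    ⟨upToDeadlock (joinTr tr5 tr5) (fun s t => s = (.AB, .E) ∧ t = (.E, .E)),
      isBisim_upToDeadlock ?_ ?_, Or.inl ⟨rfl, rfl⟩⟩, ?_⟩
  · rintro s t (rfl | ⟨rfl, rfl⟩) x s' h
    · exact ⟨s', h, Or.inl rfl⟩
    · refine ⟨s', ?_, Or.inl rfl⟩
      simp_all [tr5]
  · rintro s t ⟨rfl, rfl⟩ x s' h
    refine ⟨s', ?_, Or.inr (Or.inl rfl)⟩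
    simp_all [joinTr, tr5]
    tauto
  · rintro s t ⟨rfl, rfl⟩ x ⟨p, e⟩ h
    simp only [joinTr, tr5, reduceCtorEq, false_and, false_or, true_and] at h
    obtain ⟨⟨rfl, rfl⟩ | ⟨rfl, rfl⟩, ⟨-, rfl⟩ | ⟨-, rfl⟩⟩ := h
    · exact ⟨(.B, .B), by simp [joinTr, tr5], Or.inr (Or.inl rfl)⟩
    · exact ⟨(.B, .zero), by simp [joinTr, tr5], Or.inr (Or.inl rfl)⟩
    · exact ⟨(.B, .zero), by simp [joinTr, tr5],
        Or.inr (Or.inr (by simp [joinTr, tr5]))⟩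
    · exact ⟨(.B, .zero), by simp [joinTr, tr5],
        Or.inr (Or.inr (by simp [joinTr, tr5]))⟩
  · rintro ⟨R, ⟨hl, hr⟩, h⟩
    obtain ⟨⟨p, e⟩, hs, hR⟩ := hr _ _ h .a (.zero, .B) (by simp [joinTr, tr5])
    obtain ⟨rfl, rfl⟩ : p = .B ∧ e = .B := by simpa [joinTr, tr5] using hs
    obtain ⟨t', ht, -⟩ := hl _ _ hR .b (.zero, .zero) (by simp [joinTr, tr5])
    simp [joinTr, tr5] at ht
end

section
/- Let T = (St, →) be an LTS over an action set A equipped with a binary join operation & : St × St → St satisfying: for all s, t, w and a ∈ A, (s&t) →a w iff there exist s', t' with w = s'&t', s →a s', and t →a t'. Suppose T contains a universal state u, i.e. for every a ∈ A there exists u' with u →a u' and u' ∼ u. Taking T both as process LTS and environment LTS, for all states e, f of T: e ≤ f (e can be simulated by f) if and only if ji-parameterized simulatability with respect to f is included in ji-parameterized simulatability with respect to e, i.e. for all p, q ∈ St, (p&f) ≤ (q&f) implies (p&e) ≤ (q&e). -/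
theorem SimBy.step {A St1 St2 : Type*} {tr1 : St1 → A → St1 → Prop}
    {tr2 : St2 → A → St2 → Prop} {s s' : St1} {t : St2} {a : A}
    (h : SimBy tr1 tr2 s t) (hs : tr1 s a s') :
    ∃ t', tr2 t a t' ∧ SimBy tr1 tr2 s' t' := by
  obtain ⟨S, hS, hst⟩ := h
  obtain ⟨t', ht, hst'⟩ := hS s t hst a s' hs
  exact ⟨t', ht, S, hS, hst'⟩

theorem SimBy.refl {A St : Type*} (tr : St → A → St → Prop) (s : St) : SimBy tr tr s s :=
  ⟨Eq, by rintro s _ rfl a s' hs; exact ⟨s', hs, rfl⟩, rfl⟩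

theorem SimBy.trans {A St1 St2 St3 : Type*} {tr1 : St1 → A → St1 → Prop}
    {tr2 : St2 → A → St2 → Prop} {tr3 : St3 → A → St3 → Prop} {s : St1} {t : St2} {r : St3}
    (hst : SimBy tr1 tr2 s t) (htr : SimBy tr2 tr3 t r) : SimBy tr1 tr3 s r := by
  refine ⟨fun s r => ∃ t, SimBy tr1 tr2 s t ∧ SimBy tr2 tr3 t r, ?_, t, hst, htr⟩
  rintro s r ⟨t, hst, htr⟩ a s' hs
  obtain ⟨t', ht, hst'⟩ := hst.step hs
  obtain ⟨r', hr, htr'⟩ := htr.step ht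
  exact ⟨r', hr, t', hst', htr'⟩

theorem Bisim.simBy_symm {A St : Type*} {tr : St → A → St → Prop} {s t : St}
    (h : Bisim tr s t) : SimBy tr tr t s := by
  obtain ⟨B, hB, hst⟩ := h
  exact ⟨_, hB.2, hst⟩

theorem simBy_of_universal {A St : Type*} {tr : St → A → St → Prop} {u : St}
    (hu : ∀ a : A, ∃ u', tr u a u' ∧ Bisim tr u' u) (s : St) : SimBy tr tr s u := by
  refine ⟨fun _ t => SimBy tr tr u t, ?_, SimBy.refl tr u⟩
  intro s t hut a s' _
  obtain ⟨u', hu', hb⟩ := hu a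
  obtain ⟨t', ht, hut'⟩ := hut.step hu'
  exact ⟨t', ht, hb.simBy_symm.trans hut'⟩

theorem join_simBy_left {A St : Type*} {tr : St → A → St → Prop} {join : St → St → St}
    (hjoin : ∀ (s t : St) (a : A) (w : St),
      tr (join s t) a w ↔ ∃ s' t', w = join s' t' ∧ tr s a s' ∧ tr t a t')
    (s t : St) : SimBy tr tr (join s t) s := by
  refine ⟨fun w s => ∃ t, w = join s t, ?_, t, rfl⟩
  rintro _ s ⟨t, rfl⟩ a w hw
  obtain ⟨s', t', rfl, hs, _⟩ := (hjoin s t a w).1 hw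
  exact ⟨s', hs, t', rfl⟩

theorem join_simBy_right {A St : Type*} {tr : St → A → St → Prop} {join : St → St → St}
    (hjoin : ∀ (s t : St) (a : A) (w : St),
      tr (join s t) a w ↔ ∃ s' t', w = join s' t' ∧ tr s a s' ∧ tr t a t')
    (s t : St) : SimBy tr tr (join s t) t := by
  refine ⟨fun w t => ∃ s, w = join s t, ?_, s, rfl⟩
  rintro _ t ⟨s, rfl⟩ a w hw
  obtain ⟨s', t', rfl, _, ht⟩ := (hjoin s t a w).1 hw
  exact ⟨t', ht, s', rfl⟩

theorem simBy_join {A St : Type*} {tr : St → A → St → Prop} {join : St → St → St}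
    (hjoin : ∀ (s t : St) (a : A) (w : St),
      tr (join s t) a w ↔ ∃ s' t', w = join s' t' ∧ tr s a s' ∧ tr t a t')
    {r s t : St} (hs : SimBy tr tr r s) (ht : SimBy tr tr r t) :
    SimBy tr tr r (join s t) := by
  refine ⟨fun r w => ∃ s t, w = join s t ∧ SimBy tr tr r s ∧ SimBy tr tr r t, ?_,
    s, t, rfl, hs, ht⟩
  rintro r _ ⟨s, t, rfl, hs, ht⟩ a r' hr
  obtain ⟨s', hs', hrs⟩ := hs.step hr
  obtain ⟨t', ht', hrt⟩ := ht.step hr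
  exact ⟨join s' t', (hjoin s t a _).2 ⟨s', t', rfl, hs', ht'⟩, s', t', rfl, hrs, hrt⟩

theorem stmt13 {A St : Type*} (tr : St → A → St → Prop)
    (join : St → St → St)
    (hjoin : ∀ (s t : St) (a : A) (w : St),
      tr (join s t) a w ↔ ∃ s' t', w = join s' t' ∧ tr s a s' ∧ tr t a t')
    (u : St) (hu : ∀ a : A, ∃ u', tr u a u' ∧ Bisim tr u' u)
    (e f : St) :
    SimBy tr tr e f ↔
      ∀ p q : St, SimBy tr tr (join p f) (join q f) →
        SimBy tr tr (join p e) (join q e) := by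
  constructor
  · intro hef p q hpq
    have hpf : SimBy tr tr (join p e) (join p f) :=
      simBy_join hjoin (join_simBy_left hjoin p e) ((join_simBy_right hjoin p e).trans hef)
    exact simBy_join hjoin ((hpf.trans hpq).trans (join_simBy_left hjoin q f))
      (join_simBy_right hjoin p e)
  · intro h
    have huf := join_simBy_right hjoin u f
    have heu : SimBy tr tr e (join u e) :=
      simBy_join hjoin (simBy_of_universal hu e) (SimBy.refl tr e)
    exact (heu.trans (h u f (simBy_join hjoin huf huf))).trans (join_simBy_left hjoin f e)
end

section
/- Let P = (Pr, →) be an LTS over an action set A. For all states p, q of P, the set of positive modal formulas satisfied by the join state p&q in the join-interaction LTS P & P equals the intersection of the sets of positive formulas satisfied by p and by q in P: L(p&q) = L(p) ∩ L(q). -/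
/-- A pair satisfies a positive formula in the join LTS iff both components satisfy it. -/
theorem psat_joinTr_iff {A St1 St2 : Type*} (tr1 : St1 → A → St1 → Prop)
    (tr2 : St2 → A → St2 → Prop) (φ : PosForm A) (p : St1) (q : St2) :
    psat (joinTr tr1 tr2) φ (p, q) ↔ psat tr1 φ p ∧ psat tr2 φ q := by
  induction φ generalizing p q with
  | top => simp [psat]
  | and φ ψ ihφ ihψ =>
    simp only [psat, ihφ, ihψ]
    exact and_and_and_comm
  | dia a φ ih =>
    simp only [psat, joinTr, Prod.exists, ih]
    constructor
    · rintro ⟨p', q', ⟨hp, hq⟩, hφp, hφq⟩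
      exact ⟨⟨p', hp, hφp⟩, ⟨q', hq, hφq⟩⟩
    · rintro ⟨⟨p', hp, hφp⟩, ⟨q', hq, hφq⟩⟩
      exact ⟨p', q', ⟨hp, hq⟩, hφp, hφq⟩

theorem stmt15 {A Pr : Type*} (tr : Pr → A → Pr → Prop) (p q : Pr) :
    posSat (joinTr tr tr) (p, q) = posSat tr p ∩ posSat tr q := by
  ext φ
  exact psat_joinTr_iff tr tr φ p q
end

section
/- (Stirling–Larsen) Let P be a process LTS and E an environment LTS over the same action set A. For all image-finite processes p, q of P and every image-finite environment e of E: p ∼_e q (p and q are parameterized bisimilar with respect to e) if and only if M(p) ∩ NC(L(e)) = M(q) ∩ NC(L(e)), where M(p), M(q) are the sets of modal formulas satisfied by p, q in P, L(e) is the set of positive formulas satisfied by e in E, and NC denotes negation closure. Moreover the implication from p ∼_e q to this equality of formula sets holds for all (not necessarily image-finite) p, q, e. -/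
/-- `p` and `q` satisfy the same modal formulas among those whose positive projection
    holds at the environment `e`. -/
def ParamModalEquiv {A Pr Env : Type*} (tr : Pr → A → Pr → Prop)
    (trE : Env → A → Env → Prop) (e : Env) (p q : Pr) : Prop :=
  ∀ φ : Form A, psat trE (posProj φ) e → (msat tr φ p ↔ msat tr φ q)

theorem paramModalEquiv_iff_inter_eq {A Pr Env : Type*} {tr : Pr → A → Pr → Prop}
    {trE : Env → A → Env → Prop} {e : Env} {p q : Pr} :
    ParamModalEquiv tr trE e p q ↔
      modalSat tr p ∩ negClosure (posSat trE e) =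
        modalSat tr q ∩ negClosure (posSat trE e) := by
  simp only [Set.ext_iff, Set.mem_inter_iff, and_congr_left_iff]
  rfl

theorem ParamModalEquiv.symm {A Pr Env : Type*} {tr : Pr → A → Pr → Prop}
    {trE : Env → A → Env → Prop} {e : Env} {p q : Pr}
    (h : ParamModalEquiv tr trE e p q) : ParamModalEquiv tr trE e q p :=
  fun φ hφ => (h φ hφ).symm

theorem IsParamBisim.paramModalEquiv {A Pr Env : Type*} {tr : Pr → A → Pr → Prop}
    {trE : Env → A → Env → Prop} {B : Env → Pr → Pr → Prop}
    (hB : IsParamBisim tr trE B) {e : Env} {p q : Pr} (h : B e p q) :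
    ParamModalEquiv tr trE e p q := by
  intro φ hφ
  induction φ generalizing e p q with
  | top => exact Iff.rfl
  | neg φ ih => exact not_congr (ih h hφ)
  | and φ ψ ihφ ihψ => exact and_congr (ihφ h hφ.1) (ihψ h hφ.2)
  | dia a φ ih =>
    obtain ⟨e', he', hφ⟩ := hφ
    obtain ⟨forth, back⟩ := hB e p q h a e' he'
    constructor
    · rintro ⟨p', hp', hsat⟩
      obtain ⟨q', hq', hB'⟩ := forth p' hp'
      exact ⟨q', hq', (ih hB' hφ).1 hsat⟩
    · rintro ⟨q', hq', hsat⟩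
      obtain ⟨p', hp', hB'⟩ := back q' hq'
      exact ⟨p', hp', (ih hB' hφ).2 hsat⟩

theorem exists_distinguishing_of_not_paramModalEquiv {A Pr Env : Type*}
    {tr : Pr → A → Pr → Prop} {trE : Env → A → Env → Prop} {e : Env} {p q : Pr}
    (h : ¬ ParamModalEquiv tr trE e p q) :
    ∃ φ, psat trE (posProj φ) e ∧ msat tr φ p ∧ ¬ msat tr φ q := by
  simp only [ParamModalEquiv, not_forall] at h
  obtain ⟨φ, hφ, hne⟩ := h
  by_cases hp : msat tr φ p
  · exact ⟨φ, hφ, hp, fun hq => hne (iff_of_true hp hq)⟩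
  · exact ⟨.neg φ, hφ, hp, fun hq => hne (iff_of_false hp hq)⟩

/-- A state that is pairwise distinguishable from the members of a finite set is
    distinguished from all of them by a single formula. -/
theorem exists_distinguishing_of_finite {A Pr Env : Type*}
    {tr : Pr → A → Pr → Prop} {trE : Env → A → Env → Prop} {e : Env} {p : Pr}
    {T : Set Pr} (hT : T.Finite) (h : ∀ q ∈ T, ¬ ParamModalEquiv tr trE e p q) :
    ∃ φ, psat trE (posProj φ) e ∧ msat tr φ p ∧ ∀ q ∈ T, ¬ msat tr φ q := by
  induction T, hT using Set.Finite.induction_on with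
  | empty => exact ⟨.top, trivial, trivial, by simp⟩
  | @insert q T _ _ ih =>
    obtain ⟨φ, hφe, hφp, hφq⟩ :=
      exists_distinguishing_of_not_paramModalEquiv (h q (Set.mem_insert q T))
    obtain ⟨ψ, hψe, hψp, hψT⟩ := ih fun r hr => h r (Set.mem_insert_of_mem q hr)
    refine ⟨.and φ ψ, ⟨hφe, hψe⟩, ⟨hφp, hψp⟩, ?_⟩
    rintro r (rfl | hr) ⟨h₁, h₂⟩
    · exact hφq h₁
    · exact hψT r hr h₂

theorem ParamModalEquiv.exists_match {A Pr Env : Type*} {tr : Pr → A → Pr → Prop}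
    {trE : Env → A → Env → Prop} {e e' : Env} {p q p' : Pr} {a : A}
    (h : ParamModalEquiv tr trE e p q) (hq : {q' | tr q a q'}.Finite)
    (he : trE e a e') (hp : tr p a p') :
    ∃ q', tr q a q' ∧ ParamModalEquiv tr trE e' p' q' := by
  by_contra! hne
  obtain ⟨φ, hφe, hφp, hφq⟩ := exists_distinguishing_of_finite hq hne
  obtain ⟨q', hq', hsat⟩ := (h (.dia a φ) ⟨e', he, hφe⟩).1 ⟨p', hp, hφp⟩
  exact hφq q' hq' hsat

theorem ImageFinite.of_tr {A St : Type*} {tr : St → A → St → Prop} {s t : St} {a : A}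
    (h : ImageFinite tr s) (hst : tr s a t) : ImageFinite tr t :=
  fun u hu => h u (.head ⟨a, hst⟩ hu)

theorem isParamBisim_paramModalEquiv {A Pr Env : Type*} (tr : Pr → A → Pr → Prop)
    (trE : Env → A → Env → Prop) :
    IsParamBisim tr trE fun e p q =>
      ImageFinite tr p ∧ ImageFinite tr q ∧ ParamModalEquiv tr trE e p q := by
  rintro e p q ⟨hp, hq, h⟩ a e' he
  constructor
  · intro p' hp'
    obtain ⟨q', hq', h'⟩ := h.exists_match (hq q .refl a) he hp'
    exact ⟨q', hq', hp.of_tr hp', hq.of_tr hq', h'⟩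
  · intro q' hq'
    obtain ⟨p', hp', h'⟩ := h.symm.exists_match (hp p .refl a) he hq'
    exact ⟨p', hp', hp.of_tr hp', hq.of_tr hq', h'.symm⟩

theorem stmt19 {A Pr Env : Type*} (tr : Pr → A → Pr → Prop)
    (trE : Env → A → Env → Prop) :
    (∀ (p q : Pr) (e : Env), ParamBisim tr trE e p q →
        modalSat tr p ∩ negClosure (posSat trE e) =
          modalSat tr q ∩ negClosure (posSat trE e)) ∧
    (∀ (p q : Pr) (e : Env),
        ImageFinite tr p → ImageFinite tr q → ImageFinite trE e →
        (ParamBisim tr trE e p q ↔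
          modalSat tr p ∩ negClosure (posSat trE e) =
            modalSat tr q ∩ negClosure (posSat trE e))) := by
  have sound : ∀ (p q : Pr) (e : Env), ParamBisim tr trE e p q →
      modalSat tr p ∩ negClosure (posSat trE e) =
        modalSat tr q ∩ negClosure (posSat trE e) := by
    rintro p q e ⟨B, hB, h⟩
    exact paramModalEquiv_iff_inter_eq.1 (hB.paramModalEquiv h)
  refine ⟨sound, fun p q e hp hq _ => ⟨sound p q e, fun h => ?_⟩⟩
  exact ⟨_, isParamBisim_paramModalEquiv tr trE, hp, hq, paramModalEquiv_iff_inter_eq.2 h⟩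
end
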